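/- Let k be a field, let I ⊆ k[x_1,…,x_n] be the monomial ideal generated by x^{m_1},…,x^{m_r}, let μ ∈ ℕ^n be the componentwise maximum of m_1,…,m_r, and let P(I) be the monomial ideal of the polynomial ring k[x_{i,k} : 1 ≤ i ≤ n, 1 ≤ k ≤ μ_i] generated by the r squarefree monomials ∏_{i=1}^n ∏_{k=1}^{(m_j)_i} x_{i,k} (j = 1,…,r). Then the heights of I and P(I) coincide: height(I) = height(P(I)). -/

import Mathlib

/-- The height of an ideal `J` of a commutative ring: the infimum of the heights of the
prime ideals containing `J` (the height of a prime being the supremum of the lengths of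
chains of primes descending from it, i.e. its height in the prime spectrum). -/
noncomputable def idealHeight {R : Type*} [CommRing R] (J : Ideal R) : ℕ∞ :=
  ⨅ (P : PrimeSpectrum R) (_ : J ≤ P.asIdeal), Order.height P

open MvPolynomial in
/-- The endomorphism killing the variables in `S`. -/
noncomputable def killVars {σ : Type*} [DecidableEq σ] (k : Type*) [Field k] (S : Finset σ) :
    MvPolynomial σ k →ₐ[k] MvPolynomial σ k :=
  aeval (fun s => if s ∈ S then 0 else X s)

open MvPolynomial in
lemma ker_killVars {σ : Type*} [DecidableEq σ] (k : Type*) [Field k] (S : Finset σ) :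
    RingHom.ker (killVars k S) = Ideal.span (X '' (S : Set σ)) := by
  apply le_antisymm
  · intro f hf
    have h : ((Ideal.Quotient.mkₐ k (Ideal.span (X '' (S : Set σ) : Set (MvPolynomial σ k)))).comp
        (killVars k S)) = Ideal.Quotient.mkₐ k _ := by
      apply MvPolynomial.algHom_ext
      intro s
      by_cases hs : s ∈ S
      · have : Ideal.Quotient.mkₐ k (Ideal.span (X '' (S : Set σ) : Set (MvPolynomial σ k))) (X s)
            = 0 := by
          rw [Ideal.Quotient.mkₐ_eq_mk, Ideal.Quotient.eq_zero_iff_mem]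
          exact Ideal.subset_span ⟨s, hs, rfl⟩
        rw [this]
        simp [killVars, hs]
      · simp [killVars, hs]
    have h2 := DFunLike.congr_fun h f
    rw [AlgHom.comp_apply, (RingHom.mem_ker).1 hf, map_zero] at h2
    rw [← Ideal.Quotient.eq_zero_iff_mem, ← Ideal.Quotient.mkₐ_eq_mk k]
    exact h2.symm
  · rw [Ideal.span_le]
    rintro _ ⟨s, hs, rfl⟩
    have hs' : s ∈ S := hs
    simp [RingHom.mem_ker, killVars, hs']

open MvPolynomial in
lemma X_mem_ker_killVars {σ : Type*} [DecidableEq σ] (k : Type*) [Field k] (S : Finset σ) (s : σ) :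
    (X s : MvPolynomial σ k) ∈ RingHom.ker (killVars k S) ↔ s ∈ S := by
  by_cases h : s ∈ S <;> simp [RingHom.mem_ker, killVars, h]

open MvPolynomial in
lemma card_le_height_killVars {σ : Type*} [DecidableEq σ] (k : Type*) [Field k] (S : Finset σ) :
    (S.card : ℕ∞) ≤ (RingHom.ker (killVars k S)).height := by
  induction S using Finset.induction_on with
  | empty => simp
  | insert a S ha ih =>
    have hp1 : (RingHom.ker (killVars k S)).IsPrime := RingHom.ker_isPrime _
    have hp2 : (RingHom.ker (killVars k (insert a S))).IsPrime := RingHom.ker_isPrime _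
    have hlt : RingHom.ker (killVars k S) < RingHom.ker (killVars k (insert a S)) := by
      refine lt_of_le_not_ge ?_ ?_
      · rw [ker_killVars, ker_killVars]
        exact Ideal.span_mono (Set.image_mono (by simp))
      · intro h
        exact ha ((X_mem_ker_killVars k S a).1 (h ((X_mem_ker_killVars k _ a).2 (by simp))))
    have := Ideal.height_add_one_le_of_lt_of_isPrime hlt
    rw [Finset.card_insert_of_notMem ha]
    push_cast
    exact le_trans (by gcongr) this

open MvPolynomial in
lemma height_killVars_le {σ : Type*} [Finite σ] [DecidableEq σ] (k : Type*) [Field k]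
    (S : Finset σ) :
    (RingHom.ker (killVars k S)).height ≤ S.card := by
  classical
  have hp1 : (RingHom.ker (killVars k S)).IsPrime := RingHom.ker_isPrime _
  have h : RingHom.ker (killVars k S) ∈
      (Ideal.span ((S.image (X : σ → MvPolynomial σ k) : Finset _) : Set (MvPolynomial σ k))).minimalPrimes := by
    rw [Finset.coe_image, ← ker_killVars, Ideal.minimalPrimes_eq_subsingleton_self]
    rfl
  refine (Ideal.height_le_card_of_mem_minimalPrimes_span_finset h).trans ?_
  exact_mod_cast Finset.card_image_le

open MvPolynomial in
/-- Height of an ideal generated by elements that behave like monomials with supports `A j`. -/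
lemma idealHeight_eq_iInf_cover {σ : Type*} [Fintype σ] (k : Type*) [Field k]
    {ι : Type*} (f : ι → MvPolynomial σ k) (A : ι → Set σ)
    (hf : ∀ (P : Ideal (MvPolynomial σ k)), P.IsPrime → ∀ j, f j ∈ P ↔ ∃ s ∈ A j, X s ∈ P) :
    idealHeight (Ideal.span (Set.range f)) =
      ⨅ (S : Finset σ) (_ : ∀ j, ∃ s ∈ A j, s ∈ S), (S.card : ℕ∞) := by
  classical
  unfold idealHeight
  apply le_antisymm
  · refine le_iInf₂ fun S hS => ?_
    have hp : (RingHom.ker (killVars k S)).IsPrime := RingHom.ker_isPrime _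
    refine (iInf₂_le (⟨_, hp⟩ : PrimeSpectrum _) ?_).trans ?_
    · rw [Ideal.span_le]
      rintro _ ⟨j, rfl⟩
      obtain ⟨s, hs, hsS⟩ := hS j
      exact (hf _ hp j).2 ⟨s, hs, (X_mem_ker_killVars k S s).2 hsS⟩
    · rw [← PrimeSpectrum.height_eq_orderHeight]
      exact height_killVars_le k S
  · refine le_iInf₂ fun P hP => ?_
    refine (iInf₂_le (Finset.univ.filter fun s => (X s : MvPolynomial σ k) ∈ P.asIdeal) ?_).trans ?_
    · intro j
      obtain ⟨s, hs, hsP⟩ := (hf _ P.2 j).1 (hP (Ideal.subset_span ⟨j, rfl⟩))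
      exact ⟨s, hs, by simpa using hsP⟩
    · rw [← PrimeSpectrum.height_eq_orderHeight]
      refine (card_le_height_killVars k _).trans (Ideal.height_mono ?_)
      rw [ker_killVars, Ideal.span_le]
      rintro _ ⟨s, hs, rfl⟩
      simpa using hs

/-- Let `k` be a field, `I ⊆ k[x_1,…,x_n]` the monomial ideal generated
by `x^{m_1},…,x^{m_r}`, `μ` the componentwise maximum of `m_1,…,m_r`, and `P(I)` the
monomial ideal of `k[x_{i,l} : 1 ≤ i ≤ n, 1 ≤ l ≤ μ_i]` generated by the `r` squarefree
monomials `∏_{i=1}^n ∏_{l=1}^{(m_j)_i} x_{i,l}`.  Then `height I = height P(I)`. -/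
theorem height_eq_height_polarization {k : Type*} [Field k] {n r : ℕ}
    (m : Fin r → Fin n → ℕ)
    (μ : Fin n → ℕ)
    (hμ : ∀ i, IsGreatest (Set.range fun j => m j i) (μ i)) :
    idealHeight
        (Ideal.span (Set.range fun j : Fin r =>
          ∏ i : Fin n, MvPolynomial.X i ^ m j i) : Ideal (MvPolynomial (Fin n) k))
      = idealHeight
        (Ideal.span (Set.range fun j : Fin r =>
          ∏ i : Fin n, ∏ l : Fin (μ i),
            if (l : ℕ) < m j i then MvPolynomial.X (⟨i, l⟩ : Σ i : Fin n, Fin (μ i)) else 1)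
          : Ideal (MvPolynomial (Σ i : Fin n, Fin (μ i)) k)) := by
  classical
  rw [idealHeight_eq_iInf_cover k _ (fun j => {i | m j i ≠ 0}) ?_,
    idealHeight_eq_iInf_cover k _ (fun j => {x : Σ i : Fin n, Fin (μ i) | (x.2 : ℕ) < m j x.1}) ?_]
  · apply le_antisymm
    · refine le_iInf₂ fun T hT => ?_
      refine (iInf₂_le (T.image Sigma.fst) ?_).trans ?_
      · intro j
        obtain ⟨x, hx, hxT⟩ := hT j
        refine ⟨x.1, ?_, Finset.mem_image_of_mem _ hxT⟩
        have hx' : (x.2 : ℕ) < m j x.1 := hx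
        change m j x.1 ≠ 0
        omega
      · exact_mod_cast Finset.card_image_le
    · refine le_iInf₂ fun S hS => ?_
      refine (iInf₂_le (Finset.univ.filter fun x : Σ i : Fin n, Fin (μ i) =>
        x.1 ∈ S ∧ (x.2 : ℕ) = 0) ?_).trans ?_
      · intro j
        obtain ⟨i, hi, hiS⟩ := hS j
        have hi' : m j i ≠ 0 := hi
        have hle : m j i ≤ μ i := (hμ i).2 ⟨j, rfl⟩
        refine ⟨⟨i, ⟨0, by omega⟩⟩, ?_, by simpa using hiS⟩
        change 0 < m j i
        omega
      · have : (Finset.univ.filter fun x : Σ i : Fin n, Fin (μ i) =>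
          x.1 ∈ S ∧ (x.2 : ℕ) = 0).card ≤ S.card := by
          refine Finset.card_le_card_of_injOn Sigma.fst ?_ ?_
          · intro x hx
            simp at hx
            exact hx.1
          · rintro ⟨i, l⟩ hx ⟨i', l'⟩ hy h
            simp at hx hy h
            subst h
            congr 1
            apply Fin.ext
            rw [hx.2, hy.2]
        exact_mod_cast this
  · intro P hP j
    simp only [hP.prod_mem_iff, Finset.mem_univ, true_and]
    constructor
    · rintro ⟨i, l, h⟩
      split_ifs at h with hl
      · exact ⟨⟨i, l⟩, hl, h⟩
      · exact absurd ((Ideal.eq_top_iff_one _).2 h) hP.ne_top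
    · rintro ⟨⟨i, l⟩, hl, h⟩
      refine ⟨i, l, ?_⟩
      have hl' : (l : ℕ) < m j i := hl
      rwa [if_pos hl']
  · intro P hP j
    simp only [hP.prod_mem_iff, Finset.mem_univ, true_and]
    constructor
    · rintro ⟨i, h⟩
      refine ⟨i, ?_, hP.mem_of_pow_mem _ h⟩
      intro h0
      rw [h0, pow_zero] at h
      exact absurd ((Ideal.eq_top_iff_one _).2 h) hP.ne_top
    · rintro ⟨i, hi, h⟩
      exact ⟨i, Ideal.pow_mem_of_mem _ h _ (Nat.pos_of_ne_zero hi)⟩
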